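/- The limit as n → ∞ of ∑_{i=1}^∞ el(n,2i) equals ln 2 (for each n this sum is finite since el(n,j) = 0 for j ≥ n+2). In other words, the expected number of lucky moves in an optimally played solitaire memory game with n pairs tends to ln 2 as n → ∞. -/

import Mathlib

open scoped Classical

/-- A deal of size `n` is a fixed-point-free involution of `Fin (2*n)`. -/
def IsDeal (n : ℕ) (π : Fin (2*n) → Fin (2*n)) : Prop :=
  ∀ j, π (π j) = j ∧ π j ≠ j

/-- The finite set `D_n` of all deals of size `n`. -/
noncomputable def deals (n : ℕ) : Finset (Fin (2*n) → Fin (2*n)) :=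
  Finset.univ.filter (IsDeal n)

/-- The second occurrences of `π` (positions `j` with `π j < j`), in
increasing order: `j_1 < j_2 < ... < j_n`. -/
def blockEnds {n : ℕ} (π : Fin (2*n) → Fin (2*n)) : List (Fin (2*n)) :=
  (Finset.univ.filter (fun j => π j < j)).sort (· ≤ ·)

/-- The block lengths `b_1, ..., b_n` of a deal:
`b_1 = j_1 + 1` and `b_i = j_i - j_(i-1)` for `i ≥ 2`. -/
def blockLens {n : ℕ} (π : Fin (2*n) → Fin (2*n)) : List ℕ :=
  List.zipWith (fun x y => x - y)
    ((blockEnds π).map (fun j => (j : ℕ) + 1))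
    (0 :: (blockEnds π).map (fun j => (j : ℕ) + 1))

/-- The blocks of a deal: each block length `b_i` paired with the ending
position `j_i` of the block. -/
def blocks {n : ℕ} (π : Fin (2*n) → Fin (2*n)) : List (ℕ × Fin (2*n)) :=
  List.zip (blockLens π) (blockEnds π)

/-- The `i`-th block (ending at position `j_i`) is lucky if `π j_i = j_i - 1`. -/
def IsLuckyEnd {n : ℕ} (π : Fin (2*n) → Fin (2*n)) (j : Fin (2*n)) : Prop :=
  (π j).val = (j : ℕ) - 1

/-- `b(n,j)`: total number of blocks of length `j` over all deals in `D_n`. -/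
noncomputable def bcount (n j : ℕ) : ℕ :=
  ∑ π ∈ deals n, (blockLens π).count j

/-- `l(n,j)`: total number of lucky blocks of length `j` over all deals in `D_n`. -/
noncomputable def lcount (n j : ℕ) : ℕ :=
  ∑ π ∈ deals n, (blocks π).countP (fun p => decide (p.1 = j ∧ IsLuckyEnd π p.2))

/-- `eb(n,j)`: the expected number of blocks of length `j` in a random deal. -/
noncomputable def eb (n j : ℕ) : ℝ := (bcount n j : ℝ) / ((deals n).card : ℝ)

/-- `el(n,j)`: the expected number of lucky blocks of length `j` in a random deal. -/
noncomputable def el (n j : ℕ) : ℝ := (lcount n j : ℝ) / ((deals n).card : ℝ)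

/-- `db(n,j) = eb(n,j) - 2(2n+1)/(j(j+1)(j+2))`. -/
noncomputable def db (n j : ℕ) : ℝ :=
  eb n j - 2*(2*(n:ℝ)+1) / ((j:ℝ) * ((j:ℝ)+1) * ((j:ℝ)+2))

/-- `dl(n,j) = el(n,j) - 1/(j(j-1))`. -/
noncomputable def dl (n j : ℕ) : ℝ :=
  el n j - 1 / ((j:ℝ) * ((j:ℝ)-1))

/-- `e(π)`: the number of blocks of `π` of even length. -/
noncomputable def evenBlocks {n : ℕ} (π : Fin (2*n) → Fin (2*n)) : ℕ :=
  (blockLens π).countP (fun b => decide (Even b))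

/-- `l(π)`: the number of even-length lucky blocks of `π`. -/
noncomputable def luckyEvenBlocks {n : ℕ} (π : Fin (2*n) → Fin (2*n)) : ℕ :=
  (blocks π).countP (fun p => decide (Even p.1 ∧ IsLuckyEnd π p.2))

open Filter

open Finset in
/-- The involutions of `α` whose set of moved points is exactly `S`. -/
noncomputable def pairings {α : Type*} [Fintype α] [DecidableEq α] (S : Finset α) :
    Finset (α → α) :=
  univ.filter (fun f => ∀ x, f (f x) = x ∧ (f x = x ↔ x ∉ S))

theorem mem_pairings {α : Type*} [Fintype α] [DecidableEq α] {S : Finset α} {f : α → α} :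
    f ∈ pairings S ↔ ∀ x, f (f x) = x ∧ (f x = x ↔ x ∉ S) := by
  simp [pairings]

open Finset in
/-- Deleting the pair `{a, b}` from a pairing. -/
theorem card_pairings_filter_apply_eq {α : Type*} [Fintype α] [DecidableEq α]
    {S W R : Finset α} (hW : W ⊆ S) (hR : R ⊆ S) (hWR : Disjoint W R) {a b : α}
    (ha : a ∈ W) (hb : b ∈ R) :
    #{f ∈ pairings S | f a = b ∧ ∀ w ∈ W, f w ∈ R} =
      #{f ∈ pairings ((S.erase a).erase b) | ∀ w ∈ W.erase a, f w ∈ R.erase b} := by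
  have hab : a ≠ b := fun h => (Finset.disjoint_left.1 hWR ha) (h ▸ hb)
  refine Finset.card_bij' (fun f _ x => Equiv.swap a b (f x))
    (fun f _ x => Equiv.swap a b (f x)) ?_ ?_ ?_ ?_
  · intro f hf
    simp only [mem_filter, mem_pairings, mem_erase] at hf ⊢
    obtain ⟨h1, h2, h3⟩ := hf
    have h4 : f b = a := by rw [← h2]; exact (h1 a).1
    have key : ∀ x, x ≠ a → x ≠ b → Equiv.swap a b (f x) = f x := by
      intro x hxa hxb
      apply Equiv.swap_apply_of_ne_of_ne
      · intro h; apply hxb; rw [← (h1 x).1, h, h2]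
      · intro h; apply hxa; rw [← (h1 x).1, h, h4]
    have keya : Equiv.swap a b (f a) = a := by rw [h2]; exact Equiv.swap_apply_right a b
    have keyb : Equiv.swap a b (f b) = b := by rw [h4]; exact Equiv.swap_apply_left a b
    refine ⟨fun x => ?_, fun w hw => ?_⟩
    · by_cases hxa : x = a
      · subst hxa; simp [keya]
      by_cases hxb : x = b
      · subst hxb; simp [keyb]
      rw [key x hxa hxb, key (f x), (h1 x).1, (h1 x).2]
      · simp [hxa, hxb]
      · intro h; apply hxb; rw [← (h1 x).1, h, h2]
      · intro h; apply hxa; rw [← (h1 x).1, h, h4]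
    · have hwb : w ≠ b := fun h => (Finset.disjoint_left.1 hWR hw.2) (h ▸ hb)
      rw [key w hw.1 hwb]
      refine ⟨fun h => hw.1 ?_, h3 w hw.2⟩
      rw [← (h1 w).1, h, h4]
  · intro f hf
    simp only [mem_filter, mem_pairings, mem_erase] at hf ⊢
    obtain ⟨h1, h3⟩ := hf
    have h2 : f a = a := by rw [(h1 a).2]; simp
    have h4 : f b = b := by rw [(h1 b).2]; simp
    have key : ∀ x, x ≠ a → x ≠ b → Equiv.swap a b (f x) = f x := by
      intro x hxa hxb
      apply Equiv.swap_apply_of_ne_of_ne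
      · intro h; apply hxa; rw [← (h1 x).1, h, h2]
      · intro h; apply hxb; rw [← (h1 x).1, h, h4]
    have keya : Equiv.swap a b (f a) = b := by rw [h2]; exact Equiv.swap_apply_left a b
    have keyb : Equiv.swap a b (f b) = a := by rw [h4]; exact Equiv.swap_apply_right a b
    refine ⟨fun x => ?_, keya, fun w hw => ?_⟩
    · by_cases hxa : x = a
      · subst hxa; simp [keya, keyb, hab.symm, hW ha]
      by_cases hxb : x = b
      · subst hxb; simp [keya, keyb, hab, hR hb]
      rw [key x hxa hxb, key (f x), (h1 x).1, (h1 x).2]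
      · simp [hxa, hxb]
      · intro h; apply hxa; rw [← (h1 x).1, h, h2]
      · intro h; apply hxb; rw [← (h1 x).1, h, h4]
    · by_cases hwa : w = a
      · subst hwa; rwa [keya]
      have hwb : w ≠ b := fun h => (Finset.disjoint_left.1 hWR hw) (h ▸ hb)
      rw [key w hwa hwb]
      exact (h3 w ⟨hwa, hw⟩).2
  · intro f _; funext x; simp
  · intro f _; funext x; simp

/-- The number of pairings of `2 * n` points, that is `(2 * n - 1)‼`. -/
def pairingCount : ℕ → ℕ
  | 0 => 1
  | n + 1 => (2 * n + 1) * pairingCount n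

theorem pairingCount_pos (n : ℕ) : 0 < pairingCount n := by
  induction n with
  | zero => simp [pairingCount]
  | succ n ih => simp [pairingCount, ih]

open Finset in
theorem card_pairings_filter_eq_sum {α : Type*} [Fintype α] [DecidableEq α]
    {S W R : Finset α} (hW : W ⊆ S) (hR : R ⊆ S) (hWR : Disjoint W R) {a : α} (ha : a ∈ W) :
    #{f ∈ pairings S | ∀ w ∈ W, f w ∈ R} =
      ∑ b ∈ R, #{f ∈ pairings ((S.erase a).erase b) | ∀ w ∈ W.erase a, f w ∈ R.erase b} := by
  rw [Finset.card_eq_sum_card_fiberwise (f := fun f => f a) (t := R)]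
  · refine Finset.sum_congr rfl fun b hb => ?_
    rw [← card_pairings_filter_apply_eq hW hR hWR ha hb, filter_filter]
    congr 1
    ext f
    simp only [mem_filter]
    tauto
  · intro f hf
    simp only [coe_filter, Set.mem_ofPred_eq] at hf
    exact hf.2 a ha

open Finset in
theorem card_pairings {α : Type*} [Fintype α] [DecidableEq α] (n : ℕ) (S : Finset α)
    (hS : #S = 2 * n) : #(pairings S) = pairingCount n := by
  induction n generalizing S with
  | zero =>
    have : S = ∅ := by simpa using hS
    subst this
    rw [pairingCount, card_eq_one]
    refine ⟨id, ?_⟩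
    ext f
    simp only [mem_pairings, mem_singleton, notMem_empty, not_false_eq_true, iff_true]
    exact ⟨fun h => funext fun x => (h x).2, fun h => by simp [h]⟩
  | succ n ih =>
    obtain ⟨a, ha⟩ : S.Nonempty := by rw [← card_pos]; omega
    have h := card_pairings_filter_eq_sum (S := S) (W := {a}) (R := S.erase a) (a := a)
      (by simpa using ha) (erase_subset _ _) (by simp) (by simp)
    have h1 : {f ∈ pairings S | ∀ w ∈ ({a} : Finset α), f w ∈ S.erase a} = pairings S := by
      apply filter_true_of_mem
      intro f hf w hw
      rw [mem_singleton] at hw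
      subst hw
      rw [mem_pairings] at hf
      rw [mem_erase]
      refine ⟨fun h => ((hf w).2.1 h) ha, ?_⟩
      by_contra hc
      have := (hf (f w)).2.2 hc
      rw [(hf w).1] at this
      rw [← this] at hc
      exact hc ha
    rw [h1] at h
    rw [h, sum_congr rfl (g := fun _ => pairingCount n)]
    · rw [sum_const, card_erase_of_mem ha, hS, pairingCount]
      simp only [smul_eq_mul]
      congr 1
    · intro b hb
      rw [filter_true_of_mem (by simp), ih]
      rw [card_erase_of_mem hb, card_erase_of_mem ha]
      omega

open Finset in
/-- The number of pairings of `S` which match every point of `W` with a point of `R`. -/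
theorem card_pairings_filter {α : Type*} [Fintype α] [DecidableEq α] (m n : ℕ)
    {S W R : Finset α} (hW : W ⊆ S) (hR : R ⊆ S) (hWR : Disjoint W R) (hS : #S = 2 * n)
    (hm : #W = m) :
    #{f ∈ pairings S | ∀ w ∈ W, f w ∈ R} = (#R).descFactorial m * pairingCount (n - m) := by
  induction m generalizing S W R n with
  | zero =>
    have : W = ∅ := by simpa using hm
    subst this
    simp [card_pairings n S hS]
  | succ m ih =>
    obtain ⟨a, ha⟩ : W.Nonempty := by rw [← card_pos]; omega
    rw [card_pairings_filter_eq_sum hW hR hWR ha,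
      sum_congr rfl (g := fun _ => (#R - 1).descFactorial m * pairingCount (n - (m + 1)))]
    · rw [sum_const, smul_eq_mul, ← mul_assoc]
      congr 1
      cases #R with
      | zero => simp
      | succ r => rw [Nat.succ_descFactorial_succ, Nat.add_sub_cancel]
    · intro b hb
      have hab : a ≠ b := fun h => (Finset.disjoint_left.1 hWR ha) (h ▸ hb)
      rw [ih (n - 1), card_erase_of_mem hb, Nat.sub_sub, Nat.add_comm 1 m]
      · intro x hx
        rw [mem_erase] at hx
        simp only [mem_erase]
        exact ⟨fun h => (Finset.disjoint_left.1 hWR hx.2) (h ▸ hb), hx.1, hW hx.2⟩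
      · intro x hx
        rw [mem_erase] at hx
        simp only [mem_erase]
        exact ⟨hx.1, fun h => (Finset.disjoint_left.1 hWR ha) (h ▸ hx.2), hR hx.2⟩
      · exact hWR.mono (erase_subset _ _) (erase_subset _ _)
      · rw [card_erase_of_mem (mem_erase.2 ⟨hab.symm, hR hb⟩), card_erase_of_mem (hW ha)]
        omega
      · rw [card_erase_of_mem ha]
        omega

theorem countP_zip_diff_ge {α : Type*} [LinearOrder α] (f : α → ℕ) (hf : StrictMono f)
    (Q : α → Prop) (k : ℕ) (l : List α) (c : ℕ) (hl : l.Pairwise (· < ·))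
    (hc : ∀ x ∈ l, c < f x) :
    (List.zip (List.zipWith (fun x y => x - y) (l.map f) (c :: l.map f)) l).countP
        (fun p => decide (k ≤ p.1 ∧ Q p.2)) =
      l.countP (fun x => decide (c + k ≤ f x ∧ (∀ t ∈ l, t < x → f t + k ≤ f x) ∧ Q x)) := by
  induction l generalizing c with
  | nil => simp
  | cons a l ih =>
    rw [List.pairwise_cons] at hl
    simp only [List.map_cons, List.zipWith_cons_cons, List.zip_cons_cons, List.countP_cons]
    rw [ih (f a) hl.2 (fun x hx => hf (hl.1 x hx))]
    have hca := hc a (by simp)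
    congr 1
    · apply List.countP_congr
      intro x hx
      have hax := hl.1 x hx
      simp only [List.mem_cons, decide_eq_true_eq, forall_eq_or_imp]
      constructor
      · rintro ⟨h1, h2, h3⟩
        exact ⟨by omega, ⟨fun _ => h1, h2⟩, h3⟩
      · rintro ⟨h1, ⟨h2, h3⟩, h4⟩
        exact ⟨h2 hax, h3, h4⟩
    · have : (k ≤ f a - c ∧ Q a) ↔
          (c + k ≤ f a ∧ (∀ t ∈ a :: l, t < a → f t + k ≤ f a) ∧ Q a) := by
        have h : ∀ t ∈ a :: l, t < a → f t + k ≤ f a := by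
          intro t ht hta
          rcases List.mem_cons.1 ht with rfl | ht
          · exact absurd hta (lt_irrefl _)
          · exact absurd hta (hl.1 t ht).not_gt
        have h' : k ≤ f a - c ↔ c + k ≤ f a := by omega
        rw [h']
        tauto
      simp only [this]

/-- The total number of lucky blocks of length at least `k` over all deals in `D_n`. -/
noncomputable def luckyGe (n k : ℕ) : ℕ :=
  ∑ π ∈ deals n, (blocks π).countP (fun p => decide (k ≤ p.1 ∧ IsLuckyEnd π p.2))

theorem lcount_add_luckyGe (n k : ℕ) : lcount n k + luckyGe n (k + 1) = luckyGe n k := by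
  rw [lcount, luckyGe, luckyGe, ← Finset.sum_add_distrib]
  refine Finset.sum_congr rfl fun π _ => ?_
  induction blocks π with
  | nil => simp
  | cons p l ih =>
    simp only [List.countP_cons, decide_eq_true_eq] at ih ⊢
    rw [← ih]
    have : (k ≤ p.1) ↔ p.1 = k ∨ k + 1 ≤ p.1 := by omega
    by_cases hQ : IsLuckyEnd π p.2
    · simp only [hQ, and_true]
      split_ifs <;> omega
    · simp [hQ]

open Finset in
theorem countP_sort {α : Type*} [LinearOrder α] (s : Finset α) (P : α → Bool) :
    (s.sort (· ≤ ·)).countP P = #(s.filter (fun x => P x = true)) := by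
  have h := Multiset.coe_countP (fun x => P x = true) (s.sort (· ≤ ·))
  rw [Finset.sort_eq, Multiset.countP_eq_card_filter] at h
  simp only [Bool.decide_eq_true] at h
  exact h.symm

theorem blockLens_eq {n : ℕ} (π : Fin (2 * n) → Fin (2 * n)) :
    blockLens π = List.zipWith (fun x y => x - y)
      ((blockEnds π).map (fun j : Fin (2 * n) => (j : ℕ) + 1))
      (0 :: (blockEnds π).map (fun j : Fin (2 * n) => (j : ℕ) + 1)) := by
  have h : (do let a ← blockEnds π; pure (a : ℕ) : List ℕ) =
      (blockEnds π).map (fun j : Fin (2 * n) => (j : ℕ)) := by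
    simp [List.map_eq_flatMap]
  rw [blockLens, h]
  simp [List.map_map, Function.comp_def]

open Finset in
theorem luckyGe_eq_sum_card (n k : ℕ) :
    luckyGe n k = ∑ p : Fin (2 * n), #{π ∈ deals n | π p < p ∧ k ≤ (p : ℕ) + 1 ∧
      (∀ t, π t < t → t < p → (t : ℕ) + k ≤ p) ∧ (π p : ℕ) = (p : ℕ) - 1} := by
  have h : ∀ π : Fin (2 * n) → Fin (2 * n),
      (blocks π).countP (fun p => decide (k ≤ p.1 ∧ IsLuckyEnd π p.2)) =
      ∑ p : Fin (2 * n), if π p < p ∧ k ≤ (p : ℕ) + 1 ∧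
        (∀ t, π t < t → t < p → (t : ℕ) + k ≤ p) ∧ (π p : ℕ) = (p : ℕ) - 1 then 1 else 0 := by
    intro π
    rw [blocks, blockLens_eq, countP_zip_diff_ge (fun j : Fin (2 * n) => (j : ℕ) + 1)
      (fun a b h => by simpa using h) (IsLuckyEnd π) k (blockEnds π) 0, blockEnds, countP_sort,
      filter_filter, card_filter]
    · refine sum_congr rfl fun p _ => ?_
      refine if_congr ?_ rfl rfl
      simp only [mem_sort, mem_filter, mem_univ, true_and, IsLuckyEnd, zero_add,
        decide_eq_true_eq]
      refine and_congr_right fun _ => and_congr_right fun _ => and_congr_left fun _ => ?_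
      refine forall_congr' fun t => forall_congr' fun _ => forall_congr' fun _ => ?_
      omega
    · exact (Finset.sortedLT_sort _).pairwise
    · simp
  rw [luckyGe, sum_congr rfl fun π _ => h π, sum_comm]
  refine sum_congr rfl fun p _ => ?_
  rw [card_filter]

open Finset in
theorem deals_eq_pairings (n : ℕ) : deals n = pairings (univ : Finset (Fin (2 * n))) := by
  ext π
  simp only [deals, IsDeal, mem_pairings, mem_filter, mem_univ, true_and, not_true_eq_false,
    iff_false, ne_eq]

open Finset in
theorem card_deals (n : ℕ) : #(deals n) = pairingCount n := by
  rw [deals_eq_pairings]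
  exact card_pairings n univ (by simp)

open Finset in
theorem card_lucky_at (n m : ℕ) (p : Fin (2 * n)) (hp : m + 1 ≤ (p : ℕ)) :
    #{π ∈ deals n | π p < p ∧ m + 2 ≤ (p : ℕ) + 1 ∧
      (∀ t, π t < t → t < p → (t : ℕ) + (m + 2) ≤ p) ∧ (π p : ℕ) = (p : ℕ) - 1} =
    (2 * n - 1 - p).descFactorial m * pairingCount (n - 1 - m) := by
  have hp2 := p.isLt
  let a : Fin (2 * n) := ⟨p - 1, by omega⟩
  let s : Fin (2 * n) := ⟨p - 1 - m, by omega⟩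
  have ha : (a : ℕ) = p - 1 := rfl
  have hs : (s : ℕ) = p - 1 - m := rfl
  have haW : a ∈ Ico s p := by rw [mem_Ico, Fin.le_def, Fin.lt_def]; omega
  have hpR : p ∈ Ici p := by simp
  have hdisj : Disjoint (Ico s p) (Ici p) := by
    rw [disjoint_left]
    intro x hx hx'
    rw [mem_Ico] at hx
    rw [mem_Ici] at hx'
    exact absurd hx.2 hx'.not_gt
  have key : {π ∈ deals n | π p < p ∧ m + 2 ≤ (p : ℕ) + 1 ∧
      (∀ t, π t < t → t < p → (t : ℕ) + (m + 2) ≤ p) ∧ (π p : ℕ) = (p : ℕ) - 1} =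
      {π ∈ pairings (univ : Finset (Fin (2 * n))) | π a = p ∧ ∀ w ∈ Ico s p, π w ∈ Ici p} := by
    ext π
    rw [mem_filter, mem_filter, deals_eq_pairings]
    refine and_congr_right fun hπ => ?_
    rw [mem_pairings] at hπ
    have hne : ∀ x, π x ≠ x := fun x h => by simpa using (hπ x).2.1 h
    have hinv : ∀ x, π (π x) = x := fun x => (hπ x).1
    constructor
    · rintro ⟨-, -, h3, h4⟩
      have h5 : π p = a := Fin.ext h4
      refine ⟨by rw [← h5, hinv], fun w hw => ?_⟩
      rw [mem_Ico, Fin.le_def] at hw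
      rw [mem_Ici]
      by_contra! hlt
      rcases lt_or_gt_of_ne (hne w) with h | h
      · have := h3 w h hw.2
        omega
      · have := h3 (π w) (by rw [hinv]; exact h) hlt
        rw [Fin.lt_def] at h
        omega
    · rintro ⟨h1, h2⟩
      have h5 : π p = a := by rw [← h1, hinv]
      refine ⟨by rw [h5, Fin.lt_def]; omega, by omega, fun t ht htp => ?_, by rw [h5]⟩
      by_contra! hlt
      have := h2 t (by rw [mem_Ico, Fin.le_def]; exact ⟨by omega, htp⟩)
      rw [mem_Ici] at this
      exact absurd (ht.trans htp) this.not_gt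
  have hcard := card_pairings_filter_apply_eq (subset_univ _) (subset_univ _) hdisj haW hpR
  rw [key]
  suffices h : _ = (2 * n - 1 - (p : ℕ)).descFactorial m * pairingCount (n - 1 - m) by
    convert hcard.trans h
  rw [card_pairings_filter m (n - 1), card_erase_of_mem hpR, Fin.card_Ici]
  · congr 2
    omega
  · intro x hx
    rw [mem_erase] at hx
    simp only [mem_erase, mem_univ, and_true]
    exact ⟨fun h => disjoint_left.1 hdisj hx.2 (h ▸ hpR), hx.1⟩
  · intro x hx
    rw [mem_erase] at hx
    simp only [mem_erase, mem_univ, and_true]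
    exact ⟨hx.1, fun h => disjoint_left.1 hdisj haW (h ▸ hx.2)⟩
  · exact hdisj.mono (erase_subset _ _) (erase_subset _ _)
  · have hap : p ≠ a := by intro h; rw [Fin.ext_iff] at h; omega
    rw [card_erase_of_mem (by simp [hap]), card_erase_of_mem (mem_univ _), card_univ,
      Fintype.card_fin]
    omega
  · rw [card_erase_of_mem haW, Fin.card_Ico]
    omega

theorem sum_range_descFactorial_mul (m M : ℕ) :
    (∑ r ∈ Finset.range M, r.descFactorial m) * (m + 1) = M.descFactorial (m + 1) := by
  induction M with
  | zero => simp
  | succ M ih =>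
    rw [Finset.sum_range_succ, add_mul, ih, Nat.succ_descFactorial_succ, Nat.descFactorial_succ]
    rcases le_or_gt m M with h | h
    · obtain ⟨d, rfl⟩ := Nat.exists_eq_add_of_le h
      rw [Nat.add_sub_cancel_left]
      ring
    · rw [Nat.descFactorial_eq_zero_iff_lt.2 h]
      simp

open Finset in
theorem luckyGe_mul (n m : ℕ) :
    luckyGe n (m + 2) * (m + 1) =
      (2 * n - 1 - m).descFactorial (m + 1) * pairingCount (n - 1 - m) := by
  have h : ∀ p : Fin (2 * n), #{π ∈ deals n | π p < p ∧ m + 2 ≤ (p : ℕ) + 1 ∧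
      (∀ t, π t < t → t < p → (t : ℕ) + (m + 2) ≤ p) ∧ (π p : ℕ) = (p : ℕ) - 1} =
      if (2 * n - 1 - (p : ℕ)) < 2 * n - 1 - m then
        (2 * n - 1 - (p : ℕ)).descFactorial m * pairingCount (n - 1 - m) else 0 := by
    intro p
    have hp := p.isLt
    split_ifs with hpm
    · exact card_lucky_at n m p (by omega)
    · rw [card_eq_zero, filter_eq_empty_iff]
      rintro π - ⟨-, h, -⟩
      omega
  rw [luckyGe_eq_sum_card, sum_congr rfl fun p _ => h p,
    Fin.sum_univ_eq_sum_range (fun p => if (2 * n - 1 - p) < 2 * n - 1 - m then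
        (2 * n - 1 - p).descFactorial m * pairingCount (n - 1 - m) else 0) (2 * n),
    sum_range_reflect (fun r => if r < 2 * n - 1 - m then
        r.descFactorial m * pairingCount (n - 1 - m) else 0), ← sum_filter]
  have : filter (fun r => r < 2 * n - 1 - m) (range (2 * n)) = range (2 * n - 1 - m) := by
    ext r
    simp only [mem_filter, mem_range]
    omega
  rw [this, ← sum_mul, mul_right_comm, sum_range_descFactorial_mul]

/-- The expected number of lucky blocks of length at least `m + 2`, multiplied by `m + 1`. -/
noncomputable def scaledLuckyGe (n m : ℕ) : ℝ :=
  (((2 * n - 1 - m).descFactorial (m + 1) * pairingCount (n - 1 - m) : ℕ) : ℝ) / pairingCount n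

theorem scaledLuckyGe_nonneg (n m : ℕ) : 0 ≤ scaledLuckyGe n m := by
  unfold scaledLuckyGe
  positivity

theorem el_eq (n m : ℕ) :
    el n (m + 2) = scaledLuckyGe n m / (m + 1) - scaledLuckyGe n (m + 1) / (m + 2) := by
  have h1 := lcount_add_luckyGe n (m + 2)
  have h2 : (luckyGe n (m + 2) : ℝ) / pairingCount n = scaledLuckyGe n m / (m + 1) := by
    rw [scaledLuckyGe, ← luckyGe_mul]
    push_cast
    field_simp
  have h3 : (luckyGe n (m + 2 + 1) : ℝ) / pairingCount n =
      scaledLuckyGe n (m + 1) / (m + 2) := by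
    rw [scaledLuckyGe, ← luckyGe_mul]
    push_cast
    field_simp
    ring
  rw [← h2, ← h3, el, card_deals, ← h1]
  push_cast
  ring

theorem scaledLuckyGe_zero {n : ℕ} (hn : 1 ≤ n) : scaledLuckyGe n 0 = 1 := by
  obtain ⟨N, rfl⟩ := Nat.exists_eq_add_of_le' hn
  have h := pairingCount_pos (N + 1)
  have e : (2 * (N + 1) - 1 - 0).descFactorial (0 + 1) * pairingCount (N + 1 - 1 - 0) =
      pairingCount (N + 1) := by
    simp [pairingCount]
    left
    omega
  rw [scaledLuckyGe, e, div_self]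
  positivity

theorem scaledLuckyGe_succ {n m : ℕ} (h : m + 2 ≤ n) :
    scaledLuckyGe n (m + 1) =
      scaledLuckyGe n m * ((2 * n - 2 - 2 * m) / (2 * n - 1 - m)) := by
  obtain ⟨s, rfl⟩ := Nat.exists_eq_add_of_le h
  have e1 : 2 * (m + 2 + s) - 1 - m = m + 2 + 2 * s + 1 := by omega
  have e2 : 2 * (m + 2 + s) - 1 - (m + 1) = m + 2 + 2 * s := by omega
  have e3 : m + 2 + s - 1 - m = s + 1 := by omega
  have e4 : m + 2 + s - 1 - (m + 1) = s := by omega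
  have key : (m + 2 + 2 * s).descFactorial (m + 2) * (m + 2 + 2 * s + 1) =
      (m + 2 + 2 * s + 1).descFactorial (m + 1) * ((2 * s + 2) * (2 * s + 1)) := by
    rw [mul_comm, ← Nat.succ_descFactorial_succ, Nat.descFactorial_succ, Nat.descFactorial_succ]
    have e5 : m + 2 + 2 * s + 1 - (m + 2) = 2 * s + 1 := by omega
    have e6 : m + 2 + 2 * s + 1 - (m + 1) = 2 * s + 2 := by omega
    rw [e5, e6]
    ring
  have key' : ((m + 2 + 2 * s).descFactorial (m + 2) : ℝ) * (m + 2 + 2 * s + 1) =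
      (m + 2 + 2 * s + 1).descFactorial (m + 1) * ((2 * s + 2) * (2 * s + 1)) := by
    exact_mod_cast key
  have hD : (0 : ℝ) < pairingCount (m + 2 + s) := by exact_mod_cast pairingCount_pos _
  have hden : (2 * ((m + 2 + s : ℕ) : ℝ) - 1 - m) = m + 2 + 2 * s + 1 := by push_cast; ring
  have hpos : (0 : ℝ) < (m : ℝ) + 2 + 2 * s + 1 := by positivity
  rw [scaledLuckyGe, scaledLuckyGe, e1, e2, e3, e4, hden, pairingCount]
  have : ((m + 2 + 2 * s).descFactorial (m + 2) : ℝ) =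
      (m + 2 + 2 * s + 1).descFactorial (m + 1) * ((2 * s + 2) * (2 * s + 1)) /
        (m + 2 + 2 * s + 1) := by
    rw [eq_div_iff hpos.ne', key']
  push_cast
  rw [show m + 1 + 1 = m + 2 from rfl, this]
  field_simp
  ring

theorem scaledLuckyGe_eq_zero {n m : ℕ} (h : n ≤ m) : scaledLuckyGe n m = 0 := by
  rw [scaledLuckyGe, Nat.descFactorial_eq_zero_iff_lt.2 (by omega)]
  simp

theorem scaledLuckyGe_le_one (n m : ℕ) : scaledLuckyGe n m ≤ 1 := by
  induction m with
  | zero =>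
    rcases Nat.eq_zero_or_pos n with rfl | h
    · rw [scaledLuckyGe_eq_zero le_rfl]; norm_num
    · rw [scaledLuckyGe_zero h]
  | succ m ih =>
    rcases Nat.lt_or_ge n (m + 2) with h | h
    · rw [scaledLuckyGe_eq_zero (by omega)]; norm_num
    · rw [scaledLuckyGe_succ h]
      have h' : (m : ℝ) + 2 ≤ n := by exact_mod_cast h
      have hm : (0 : ℝ) ≤ m := m.cast_nonneg
      refine mul_le_one₀ ih (div_nonneg (by linarith) (by linarith)) ?_
      exact div_le_one_of_le₀ (by linarith) (by linarith)

theorem tendsto_scaledLuckyGe (m : ℕ) :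
    Tendsto (fun n => scaledLuckyGe n m) atTop (nhds 1) := by
  induction m with
  | zero =>
    refine tendsto_const_nhds.congr' ?_
    filter_upwards [eventually_ge_atTop 1] with n hn
    rw [scaledLuckyGe_zero hn]
  | succ m ih =>
    have h : Tendsto (fun n : ℕ => (1 : ℝ) - (m + 1) / (2 * n - 1 - m)) atTop (nhds (1 - 0)) := by
      refine tendsto_const_nhds.sub (Tendsto.div_atTop tendsto_const_nhds ?_)
      simp only [sub_eq_add_neg]
      exact tendsto_atTop_add_const_right _ _ (tendsto_atTop_add_const_right _ _
        (tendsto_natCast_atTop_atTop.const_mul_atTop two_pos))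
    have h2 := ih.mul h
    rw [sub_zero, mul_one] at h2
    refine h2.congr' ?_
    filter_upwards [eventually_ge_atTop (m + 2)] with n hn
    have h' : (m : ℝ) + 2 ≤ n := by exact_mod_cast hn
    have hm : (0 : ℝ) ≤ m := m.cast_nonneg
    have hne : (2 * (n : ℝ) - 1 - m) ≠ 0 := by
      have : 0 < (2 * (n : ℝ) - 1 - m) := by linarith
      exact this.ne'
    rw [scaledLuckyGe_succ hn]
    congr 1
    field_simp
    ring

theorem el_nonneg (n j : ℕ) : 0 ≤ el n j := by
  unfold el
  positivity

theorem sum_el_even_add_le (n K L : ℕ) :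
    ∑ i ∈ Finset.range L, el n (2 * (i + K + 1)) ≤ 1 / (2 * K + 1) := by
  have h : ∑ i ∈ Finset.range L, el n (2 * (i + K + 1)) +
      scaledLuckyGe n (2 * (L + K)) / ((2 * (L + K) : ℕ) + 1) ≤
        scaledLuckyGe n (2 * K) / ((2 * K : ℕ) + 1) := by
    induction L with
    | zero => simp
    | succ L ih =>
      have h1 := el_eq n (2 * (L + K))
      have h2 := el_eq n (2 * (L + K) + 1)
      have h3 := el_nonneg n (2 * (L + K) + 1 + 2)
      have e : 2 * (L + 1 + K) = 2 * (L + K) + 1 + 1 := by ring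
      have e' : 2 * (L + K + 1) = 2 * (L + K) + 2 := by ring
      have c1 : (((2 * (L + K) + 1 : ℕ) : ℝ) + 1) = ((2 * (L + K) : ℕ) : ℝ) + 2 := by
        push_cast; ring
      have c2 : (((2 * (L + K) + 1 : ℕ) : ℝ) + 2) = ((2 * (L + K) + 1 + 1 : ℕ) : ℝ) + 1 := by
        push_cast; ring
      rw [c1, c2] at h2
      rw [Finset.sum_range_succ, e, e', h1]
      linarith
  have h4 : scaledLuckyGe n (2 * K) / ((2 * K : ℕ) + 1) ≤ 1 / (2 * K + 1) := by
    push_cast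
    gcongr
    exact scaledLuckyGe_le_one n _
  have h5 : 0 ≤ scaledLuckyGe n (2 * (L + K)) / ((2 * (L + K) : ℕ) + 1) :=
    div_nonneg (scaledLuckyGe_nonneg _ _) (by positivity)
  linarith

theorem summable_el_even (n : ℕ) : Summable fun i => el n (2 * (i + 1)) :=
  summable_of_sum_range_le (fun _ => el_nonneg _ _) (sum_el_even_add_le n 0)

theorem abs_tsum_el_even_sub_le (n K : ℕ) :
    |∑' i, el n (2 * (i + 1)) - ∑ i ∈ Finset.range K, el n (2 * (i + 1))| ≤ 1 / (2 * K + 1) := by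
  rw [← (summable_el_even n).sum_add_tsum_nat_add K, add_sub_cancel_left,
    abs_of_nonneg (tsum_nonneg fun _ => el_nonneg _ _)]
  exact Real.tsum_le_of_sum_range_le (fun _ => el_nonneg _ _) (sum_el_even_add_le n K)

theorem tendsto_sum_el_even (K : ℕ) :
    Tendsto (fun n => ∑ i ∈ Finset.range K, el n (2 * (i + 1))) atTop
      (nhds (∑ i ∈ Finset.range K, (1 / (2 * (i : ℝ) + 1) - 1 / (2 * i + 2)))) := by
  refine tendsto_finsetSum _ fun i _ => ?_
  have h := ((tendsto_scaledLuckyGe (2 * i)).div_const ((2 * i : ℕ) + 1 : ℝ)).sub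
    ((tendsto_scaledLuckyGe (2 * i + 1)).div_const ((2 * i : ℕ) + 2 : ℝ))
  push_cast at h
  refine h.congr fun n => ?_
  rw [show 2 * (i + 1) = 2 * i + 2 by ring, el_eq]
  push_cast
  rfl

theorem sum_alternating_eq_harmonic_sub (K : ℕ) :
    ∑ i ∈ Finset.range K, (1 / (2 * (i : ℝ) + 1) - 1 / (2 * i + 2)) =
      (harmonic (2 * K) : ℝ) - harmonic K := by
  induction K with
  | zero => simp
  | succ K ih =>
    rw [Finset.sum_range_succ, ih, show 2 * (K + 1) = 2 * K + 1 + 1 by ring, harmonic_succ,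
      harmonic_succ, harmonic_succ]
    push_cast
    field_simp
    ring

theorem tendsto_sum_alternating :
    Tendsto (fun K => ∑ i ∈ Finset.range K, (1 / (2 * (i : ℝ) + 1) - 1 / (2 * i + 2))) atTop
      (nhds (Real.log 2)) := by
  have h := Real.tendsto_harmonic_sub_log
  have h2 := (h.comp (tendsto_id.const_mul_atTop' (two_pos : 0 < (2 : ℕ)))).sub h
  have h3 := h2.add_const (Real.log 2)
  rw [sub_self, zero_add] at h3
  refine h3.congr' ?_
  filter_upwards [eventually_ne_atTop 0] with K hK
  rw [sum_alternating_eq_harmonic_sub]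
  simp only [Function.comp_apply, id_eq, Nat.cast_mul, Nat.cast_ofNat]
  rw [Real.log_mul two_ne_zero (Nat.cast_ne_zero.2 hK)]
  ring

/-- The expected number of lucky moves, `∑_{i=1}^∞ el(n,2i)`, tends to `ln 2`
as `n → ∞`. -/
theorem tendsto_expected_lucky_moves :
    Tendsto (fun n : ℕ => ∑' i : ℕ, el n (2*(i+1))) atTop
      (nhds (Real.log 2)) := by
  have hunif : TendstoUniformly
      (fun (K n : ℕ) => ∑ i ∈ Finset.range K, el n (2 * (i + 1)))
      (fun n => ∑' i, el n (2 * (i + 1))) atTop := by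
    rw [Metric.tendstoUniformly_iff]
    intro ε hε
    have h0 : Tendsto (fun K : ℕ => (1 : ℝ) / (2 * K + 1)) atTop (nhds 0) :=
      Tendsto.div_atTop tendsto_const_nhds (tendsto_atTop_add_const_right _ _
        (tendsto_natCast_atTop_atTop.const_mul_atTop (by norm_num)))
    filter_upwards [h0.eventually_lt_const hε] with K hK n
    rw [Real.dist_eq]
    exact (abs_tsum_el_even_sub_le n K).trans_lt hK
  exact hunif.tendsto_of_eventually_tendsto (Eventually.of_forall tendsto_sum_el_even)
    tendsto_sum_alternating
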